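/- arXiv:1206.6354 — 2 statements merged into one kernel-verified Lean document; each statement's English description precedes it below -/
import Mathlib

section
/- As ℓ → ∞, r_ℓ is asymptotic to ℓ! / (2 · (log 2)^{ℓ+1}); that is, the ratio r_ℓ · 2 · (log 2)^{ℓ+1} / ℓ! tends to 1. -/
/-- `IsBPA m ℓ f` : `f` encodes a barred preferential arrangement of `[ℓ]` with `m` bars.
Each element of `[ℓ]` is assigned a section (one of the `m + 1` sections determined by the
`m` bars) together with a rank inside its section (ties are allowed: elements of the same
section with the same rank form a block); within each section the set of ranks actually used
must be an initial segment `{0, …, t-1}`, so that `f` determines, for each section, an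
ordered partition of the elements assigned to it into nonempty blocks. -/
def IsBPA (m ℓ : ℕ) (f : Fin ℓ → Fin (m + 1) × Fin ℓ) : Prop :=
  ∀ x : Fin ℓ, ∀ r : Fin ℓ, r < (f x).2 → ∃ y : Fin ℓ, (f y).1 = (f x).1 ∧ (f y).2 = r

instance (m ℓ : ℕ) : DecidablePred (IsBPA m ℓ) := fun f => by unfold IsBPA; infer_instance

/-- `bpa m ℓ` : the number of barred preferential arrangements of `[ℓ]` with `m` bars.
In particular `bpa 0 ℓ` is the number of preferential arrangements of `[ℓ]`
(the Fubini / ordered Bell number `r_ℓ`). -/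
def bpa (m ℓ : ℕ) : ℕ :=
  Fintype.card { f : Fin ℓ → Fin (m + 1) × Fin ℓ // IsBPA m ℓ f }

/-- Preferential arrangements of `α`, encoded by their rank functions: the ranks used form an
initial segment of `ℕ`. -/
def PrefArr (α : Type*) : Type _ :=
  { f : α → ℕ // ∀ x, ∀ r < f x, ∃ y, f y = r }

namespace PrefArr

/-- Relabelling the ground set. -/
def congr {α β : Type*} (e : α ≃ β) : PrefArr α ≃ PrefArr β where
  toFun f := ⟨f.1 ∘ e.symm, fun x r hr => by
    obtain ⟨y, hy⟩ := f.2 _ r hr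
    exact ⟨e y, by simpa using hy⟩⟩
  invFun f := ⟨f.1 ∘ e, fun x r hr => by
    obtain ⟨y, hy⟩ := f.2 _ r hr
    exact ⟨e.symm y, by simpa using hy⟩⟩
  left_inv f := Subtype.ext (by ext; simp)
  right_inv f := Subtype.ext (by ext; simp)

theorem lt_card {α : Type*} [Fintype α] (f : PrefArr α) (x : α) : f.1 x < Fintype.card α := by
  classical
  have h : Finset.range (f.1 x + 1) ⊆ Finset.univ.image f.1 := by
    intro r hr
    rcases (Nat.lt_succ_iff.1 (Finset.mem_range.1 hr)).lt_or_eq with h | h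
    · obtain ⟨y, hy⟩ := f.2 x r h
      exact Finset.mem_image.2 ⟨y, Finset.mem_univ _, hy⟩
    · exact Finset.mem_image.2 ⟨x, Finset.mem_univ _, h.symm⟩
  have := (Finset.card_le_card h).trans Finset.card_image_le
  rw [Finset.card_range, Finset.card_univ] at this
  exact this

instance {α : Type*} [Finite α] : Finite (PrefArr α) := by
  have := Fintype.ofFinite α
  refine Finite.of_injective
    (fun f : PrefArr α => fun x => (⟨f.1 x, f.lt_card x⟩ : Fin (Fintype.card α))) ?_
  intro f g h
  refine Subtype.ext (funext fun x => ?_)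
  simpa using congrFun h x

theorem exists_eq_zero {α : Type*} [Nonempty α] (f : PrefArr α) : ∃ x, f.1 x = 0 := by
  obtain ⟨x⟩ := ‹Nonempty α›
  rcases Nat.eq_zero_or_pos (f.1 x) with h | h
  · exact ⟨x, h⟩
  · exact f.2 x 0 h

/-- Splitting off the first block of a preferential arrangement. -/
def splitFirst (α : Type*) [Fintype α] [DecidableEq α] [Nonempty α] :
    PrefArr α ≃ Σ S : { S : Finset α // S.Nonempty }, PrefArr { x // x ∉ S.1 } where
  toFun f := ⟨⟨Finset.univ.filter (f.1 · = 0), by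
      obtain ⟨x, hx⟩ := f.exists_eq_zero
      exact ⟨x, by simpa using hx⟩⟩,
    ⟨fun x => f.1 x - 1, fun x r hr => by
      obtain ⟨y, hy⟩ := f.2 x.1 (r + 1) (by have : r < f.1 x.1 - 1 := hr; omega)
      exact ⟨⟨y, by simp [hy]⟩, by simp [hy]⟩⟩⟩
  invFun p := ⟨fun x => if h : x ∈ p.1.1 then 0 else p.2.1 ⟨x, h⟩ + 1, fun x r hr => by
    rcases r with _ | r
    · obtain ⟨y, hy⟩ := p.1.2
      exact ⟨y, by simp [hy]⟩
    · by_cases h : x ∈ p.1.1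
      · simp [h] at hr
      · obtain ⟨y, hy⟩ := p.2.2 ⟨x, h⟩ r (by simpa [h] using hr)
        exact ⟨y, by simp [y.2, hy]⟩⟩
  left_inv f := by
    refine Subtype.ext (funext fun x => ?_)
    by_cases h : f.1 x = 0
    · simp [h]
    · simp [h]; omega
  right_inv := by
    rintro ⟨⟨S, hS⟩, g⟩
    have key : ∀ (S' : Finset α) (hS' : S'.Nonempty) (g' : PrefArr { x // x ∉ S' }),
        S' = S → (∀ x h h', g'.1 ⟨x, h⟩ = g.1 ⟨x, h'⟩) →
        (⟨⟨S', hS'⟩, g'⟩ : Σ S : { S : Finset α // S.Nonempty }, PrefArr { x // x ∉ S.1 })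
          = ⟨⟨S, hS⟩, g⟩ := by
      rintro S' hS' g' rfl h
      congr 1
      exact Subtype.ext (funext fun x => h x.1 x.2 x.2)
    refine key _ _ _ ?_ ?_
    · ext x
      simp
    · intro x h h'
      simp [h']

/-- The number of preferential arrangements of `n` elements (Fubini numbers). -/
noncomputable def count (n : ℕ) : ℕ := Nat.card (PrefArr (Fin n))

theorem natCard_eq_count {α : Type*} [Fintype α] : Nat.card (PrefArr α) = count (Fintype.card α) :=
  Nat.card_congr (congr (Fintype.equivFin α))

theorem count_zero : count 0 = 1 := by
  unfold count
  have : Unique (PrefArr (Fin 0)) :=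
    { default := ⟨Fin.elim0, fun x => x.elim0⟩
      uniq := fun f => Subtype.ext (funext fun x => x.elim0) }
  exact Nat.card_unique

theorem two_mul_count {n : ℕ} (hn : n ≠ 0) :
    2 * count n = ∑ k ∈ Finset.range (n + 1), n.choose k * count (n - k) := by
  have : NeZero n := ⟨hn⟩
  have h1 : count n = ∑ S : { S : Finset (Fin n) // S.Nonempty }, count (n - S.1.card) := by
    rw [count, Nat.card_congr (splitFirst (Fin n)), Nat.card_sigma]
    refine Finset.sum_congr rfl fun S _ => ?_
    rw [natCard_eq_count, Fintype.card_subtype_compl]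
    simp
  have h2 : ∑ S : { S : Finset (Fin n) // S.Nonempty }, count (n - S.1.card)
      = ∑ S ∈ (Finset.univ : Finset (Finset (Fin n))).erase ∅, count (n - S.card) := by
    rw [← Finset.sum_subtype (Finset.univ.erase ∅) (fun S => by
      simp [Finset.nonempty_iff_ne_empty]) (fun S : Finset (Fin n) => count (n - S.card))]
  have h3 := Finset.add_sum_erase Finset.univ (fun S : Finset (Fin n) => count (n - S.card))
    (Finset.mem_univ ∅)
  have h4 := Finset.sum_powerset_apply_card (fun k => count (n - k))
    (x := (Finset.univ : Finset (Fin n)))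
  simp only [Finset.powerset_univ, Finset.card_univ, Fintype.card_fin, smul_eq_mul] at h4
  rw [← h4, ← h3, ← h2, ← h1]
  simp [two_mul]

end PrefArr

theorem bpa_zero_eq_count (n : ℕ) : bpa 0 n = PrefArr.count n := by
  rw [bpa, PrefArr.count, ← Nat.card_eq_fintype_card]
  refine Nat.card_congr
    { toFun := fun f => ⟨fun x => (f.1 x).2, fun x r hr => ?_⟩
      invFun := fun g => ⟨fun x => (0, ⟨g.1 x, by simpa using g.lt_card x⟩), fun x r hr => ?_⟩
      left_inv := fun f => ?_
      right_inv := fun g => rfl }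
  · obtain ⟨y, -, hy⟩ := f.2 x ⟨r, hr.trans (f.1 x).2.2⟩ hr
    exact ⟨y, by simp [hy]⟩
  · obtain ⟨y, hy⟩ := g.2 x r hr
    exact ⟨y, rfl, Fin.ext hy⟩
  · refine Subtype.ext (funext fun x => Prod.ext (Fin.ext (by simp)) rfl)

/-- If `t` is nonnegative with sum `c < 1`, then the reciprocal of the power series
`1 + ∑ t i X ^ (i + 1)` has absolutely summable coefficients. -/
theorem summable_of_renewal {t d : ℕ → ℝ} {c : ℝ} (ht : ∀ i, 0 ≤ t i) (hc : HasSum t c)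
    (hc1 : c < 1) (h0 : d 0 = 1)
    (hd : ∀ n, d (n + 1) = -∑ k ∈ Finset.range (n + 1), d k * t (n - k)) :
    Summable fun n => |d n| := by
  have hstep : ∀ N, ∑ n ∈ Finset.range (N + 1), |d n|
      ≤ 1 + c * ∑ n ∈ Finset.range N, |d n| := by
    intro N
    rw [Finset.sum_range_succ', h0, abs_one, add_comm]
    gcongr
    calc ∑ n ∈ Finset.range N, |d (n + 1)|
        ≤ ∑ n ∈ Finset.range N, ∑ k ∈ Finset.range (n + 1), |d k| * t (n - k) := by
          refine Finset.sum_le_sum fun n _ => ?_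
          rw [hd, abs_neg]
          refine (Finset.abs_sum_le_sum_abs _ _).trans_eq (Finset.sum_congr rfl fun k _ => ?_)
          rw [abs_mul, abs_of_nonneg (ht _)]
      _ = ∑ m ∈ Finset.range N, ∑ k ∈ Finset.range (N - m), |d m| * t k :=
          Finset.sum_range_diag_flip N fun k i => |d k| * t i
      _ ≤ ∑ m ∈ Finset.range N, |d m| * c := by
          refine Finset.sum_le_sum fun m _ => ?_
          rw [← Finset.mul_sum]
          exact mul_le_mul_of_nonneg_left (sum_le_hasSum _ (fun i _ => ht i) hc) (abs_nonneg _)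
      _ = c * ∑ n ∈ Finset.range N, |d n| := by rw [← Finset.sum_mul, mul_comm]
  have hc0 : 0 ≤ c := hc.nonneg ht
  refine summable_of_sum_range_le (c := 1 / (1 - c)) (fun _ => abs_nonneg _) fun N => ?_
  rw [le_div_iff₀ (by linarith)]
  have h := hstep N
  rw [Finset.sum_range_succ] at h
  linarith [abs_nonneg (d N)]

/-- The terms of the exponential series at `log 2`. -/
noncomputable def expTerm (n : ℕ) : ℝ := Real.log 2 ^ n / (n.factorial : ℝ)

/-- The tails of the exponential series at `log 2`. -/
noncomputable def expTail (n : ℕ) : ℝ := 2 - ∑ k ∈ Finset.range (n + 1), expTerm k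

theorem hasSum_expTerm : HasSum expTerm 2 := by
  have h := NormedSpace.expSeries_div_hasSum_exp (𝔸 := ℝ) (Real.log 2)
  rwa [← Real.exp_eq_exp_ℝ, Real.exp_log two_pos] at h

theorem expTerm_nonneg (n : ℕ) : 0 ≤ expTerm n := by
  have := Real.log_pos one_lt_two
  unfold expTerm
  positivity

theorem succ_mul_expTerm_succ (n : ℕ) :
    ((n : ℝ) + 1) * expTerm (n + 1) = Real.log 2 * expTerm n := by
  unfold expTerm
  rw [Nat.factorial_succ]
  push_cast
  field_simp
  ring

theorem hasSum_expTail (n : ℕ) : HasSum (fun i => expTerm (i + (n + 1))) (expTail n) :=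
  (hasSum_nat_add_iff' (n + 1)).2 hasSum_expTerm

theorem expTail_nonneg (n : ℕ) : 0 ≤ expTail n :=
  (hasSum_expTail n).nonneg fun _ => expTerm_nonneg _

theorem tendsto_expTail : Filter.Tendsto expTail Filter.atTop (nhds 0) := by
  have h := (Filter.tendsto_add_atTop_iff_nat 1).2 hasSum_expTerm.tendsto_sum_nat
  have h2 := h.const_sub 2
  rwa [sub_self] at h2

theorem mul_expTail_succ_le (n : ℕ) :
    ((n : ℝ) + 2) * expTail (n + 1) ≤ Real.log 2 * expTail n := by
  refine hasSum_le (fun i => ?_) ((hasSum_expTail (n + 1)).mul_left ((n : ℝ) + 2))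
    ((hasSum_expTail n).mul_left (Real.log 2))
  rw [← succ_mul_expTerm_succ]
  refine mul_le_mul_of_nonneg_right ?_ (expTerm_nonneg _)
  push_cast
  linarith [(Nat.cast_nonneg i : (0 : ℝ) ≤ i)]

theorem sum_expTail (n : ℕ) :
    ∑ k ∈ Finset.range (n + 1), expTail k
      = ((n : ℝ) + 1) * expTail n + Real.log 2 * ∑ k ∈ Finset.range n, expTerm k := by
  induction n with
  | zero => simp
  | succ n ih =>
    have h : expTail (n + 1) = expTail n - expTerm (n + 1) := by
      simp only [expTail, Finset.sum_range_succ _ (n + 1)]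
      ring
    rw [Finset.sum_range_succ, ih, Finset.sum_range_succ _ n, mul_add, ← succ_mul_expTerm_succ, h]
    push_cast
    ring

theorem hasSum_expTail_total : HasSum expTail (2 * Real.log 2) := by
  rw [hasSum_iff_tendsto_nat_of_nonneg expTail_nonneg, ← Filter.tendsto_add_atTop_iff_nat 2]
  have h1 : Filter.Tendsto (fun n : ℕ => ((n : ℝ) + 2) * expTail (n + 1)) Filter.atTop (nhds 0) := by
    refine squeeze_zero (fun n => mul_nonneg (by positivity) (expTail_nonneg _))
      mul_expTail_succ_le ?_
    simpa using tendsto_expTail.const_mul (Real.log 2)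
  have h2 := ((Filter.tendsto_add_atTop_iff_nat 1).2
    hasSum_expTerm.tendsto_sum_nat).const_mul (Real.log 2)
  have h := h1.add h2
  rw [zero_add, mul_comm] at h
  refine h.congr fun n => ?_
  rw [sum_expTail (n + 1)]
  push_cast
  ring

theorem expTail_zero : expTail 0 = 1 := by
  norm_num [expTail, expTerm]

/-- The Fubini numbers rescaled to a bounded sequence. -/
noncomputable def scaledCount (n : ℕ) : ℝ :=
  PrefArr.count n * Real.log 2 ^ n / (n.factorial : ℝ)

theorem scaledCount_renewal :
    (2 - PowerSeries.mk expTerm) * PowerSeries.mk scaledCount = 1 := by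
  rw [sub_mul, sub_eq_iff_eq_add]
  ext n
  rw [two_mul, map_add, map_add, PowerSeries.coeff_one, PowerSeries.coeff_mul,
    Finset.Nat.sum_antidiagonal_eq_sum_range_succ_mk]
  simp only [PowerSeries.coeff_mk]
  rcases eq_or_ne n 0 with rfl | hn
  · simp [scaledCount, expTerm, PrefArr.count_zero]
  · rw [if_neg hn, zero_add]
    have h : (2 * PrefArr.count n : ℝ)
        = ∑ k ∈ Finset.range (n + 1), (n.choose k : ℝ) * PrefArr.count (n - k) := by
      exact_mod_cast PrefArr.two_mul_count hn
    calc scaledCount n + scaledCount n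
        = (2 * PrefArr.count n : ℝ) * (Real.log 2 ^ n / (n.factorial : ℝ)) := by
          unfold scaledCount; ring
      _ = _ := by
          rw [h, Finset.sum_mul]
          refine Finset.sum_congr rfl fun k hk => ?_
          have hk : k ≤ n := Nat.lt_succ_iff.1 (Finset.mem_range.1 hk)
          rw [Nat.cast_choose ℝ hk, expTerm, scaledCount]
          rw [← pow_mul_pow_sub (Real.log 2) hk]
          have := Nat.factorial_ne_zero n
          field_simp

/-- The increments of the rescaled Fubini numbers, as a power series. -/
noncomputable def incrementSeries : PowerSeries ℝ :=
  (1 - PowerSeries.X) * PowerSeries.mk scaledCount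

theorem incrementSeries_mul_expTail :
    incrementSeries * PowerSeries.mk expTail = 1 := by
  have hT : PowerSeries.mk expTail = (2 - PowerSeries.mk expTerm) * PowerSeries.mk 1 := by
    ext n
    have h2 : (2 : PowerSeries ℝ) = PowerSeries.C (2 : ℝ) :=
      (map_ofNat PowerSeries.C 2).symm
    rw [sub_mul, map_sub, h2, PowerSeries.coeff_C_mul, PowerSeries.coeff_mul,
      Finset.Nat.sum_antidiagonal_eq_sum_range_succ_mk]
    simp [expTail]
  have h1 := PowerSeries.mk_one_mul_one_sub_eq_one ℝ
  rw [hT, incrementSeries]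
  linear_combination (PowerSeries.mk 1 * (1 - PowerSeries.X)) * scaledCount_renewal + h1

theorem sum_coeff_incrementSeries (n : ℕ) :
    ∑ k ∈ Finset.range (n + 1), PowerSeries.coeff k incrementSeries = scaledCount n := by
  have h : incrementSeries * PowerSeries.mk 1 = PowerSeries.mk scaledCount := by
    rw [incrementSeries]
    linear_combination PowerSeries.mk scaledCount * PowerSeries.mk_one_mul_one_sub_eq_one ℝ
  have := congrArg (PowerSeries.coeff n) h
  rw [PowerSeries.coeff_mul, Finset.Nat.sum_antidiagonal_eq_sum_range_succ_mk] at this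
  simpa using this

theorem sum_incrementSeries_mul_expTail (n : ℕ) :
    ∑ k ∈ Finset.range (n + 1), PowerSeries.coeff k incrementSeries * expTail (n - k)
      = if n = 0 then 1 else 0 := by
  have := congrArg (PowerSeries.coeff n) incrementSeries_mul_expTail
  rw [PowerSeries.coeff_mul, Finset.Nat.sum_antidiagonal_eq_sum_range_succ_mk,
    PowerSeries.coeff_one] at this
  simpa using this

theorem summable_abs_increment :
    Summable fun n => |PowerSeries.coeff n incrementSeries| := by
  have hc := (hasSum_nat_add_iff' 1).2 hasSum_expTail_total
  rw [Finset.sum_range_one, expTail_zero] at hc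
  refine summable_of_renewal (fun _ => expTail_nonneg _) hc
    (by linarith [Real.log_two_lt_d9]) ?_ fun n => ?_
  · simpa [expTail_zero] using sum_incrementSeries_mul_expTail 0
  · have h := sum_incrementSeries_mul_expTail (n + 1)
    rw [Finset.sum_range_succ, Nat.sub_self, expTail_zero, if_neg n.succ_ne_zero, mul_one] at h
    rw [eq_neg_of_add_eq_zero_right h, neg_inj]
    refine Finset.sum_congr rfl fun k hk => ?_
    rw [Nat.sub_add_comm (Nat.lt_succ_iff.1 (Finset.mem_range.1 hk))]

theorem tsum_increment :
    (∑' n, PowerSeries.coeff n incrementSeries) * (2 * Real.log 2) = 1 := by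
  rw [← hasSum_expTail_total.tsum_eq, tsum_mul_tsum_eq_tsum_sum_range_of_summable_norm
    summable_abs_increment.of_abs.norm hasSum_expTail_total.summable.norm]
  simp only [sum_incrementSeries_mul_expTail, tsum_ite_eq]

theorem tendsto_scaledCount :
    Filter.Tendsto (fun n => scaledCount n * (2 * Real.log 2)) Filter.atTop (nhds 1) := by
  have h := (Filter.tendsto_add_atTop_iff_nat 1).2
    summable_abs_increment.of_abs.hasSum.tendsto_sum_nat
  simp only [sum_coeff_incrementSeries] at h
  simpa only [tsum_increment] using h.mul_const (2 * Real.log 2)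

/-- As `ℓ → ∞`, `r_ℓ ∼ ℓ! / (2 · (log 2)^{ℓ+1})`: the ratio
`r_ℓ · 2 · (log 2)^{ℓ+1} / ℓ!` tends to `1`. -/
theorem pa_asymptotic :
    Filter.Tendsto
      (fun ℓ : ℕ => (bpa 0 ℓ : ℝ) * 2 * Real.log 2 ^ (ℓ + 1) / (Nat.factorial ℓ : ℝ))
      Filter.atTop (nhds 1) := by
  refine tendsto_scaledCount.congr fun n => ?_
  rw [bpa_zero_eq_count, scaledCount]
  ring
end

section
/- For every fixed integer m ≥ 0, as ℓ → ∞, r_{m,ℓ} is asymptotic to (ℓ+m)! / (2^{m+1} · m! · (log 2)^{ℓ+m+1}); that is, the ratio of r_{m,ℓ} to this quantity tends to 1 as ℓ → ∞. -/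
section

open Finset Filter Topology

theorem image_univ_eq_insert_tail {α : Type*} [DecidableEq α] {n : ℕ} (f : Fin (n + 1) → α) :
    univ.image f = insert (f 0) (univ.image (Fin.tail f)) := by
  ext b
  simp [Fin.exists_fin_succ, Fin.tail, eq_comm]

theorem card_filter_image_eq {α : Type*} [Fintype α] [DecidableEq α] (n : ℕ) (D : Finset α) :
    #{f : Fin n → α | univ.image f = D} = (#D).factorial * n.stirlingSecond #D := by
  induction n generalizing D with
  | zero =>
    rcases D.eq_empty_or_nonempty with rfl | hD
    · simp
    · obtain ⟨k, hk⟩ := Nat.exists_eq_succ_of_ne_zero hD.card_pos.ne'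
      simp [hk, hD.ne_empty.symm]
  | succ n ih =>
    have key : #{f : Fin (n + 1) → α | univ.image f = D} =
        ∑ a ∈ D, (#{g : Fin n → α | univ.image g = D} +
          #{g : Fin n → α | univ.image g = D.erase a}) := by
      rw [card_eq_sum_card_fiberwise (f := fun f : Fin (n + 1) → α => f 0) (t := D)]
      · refine sum_congr rfl fun a ha => ?_
        rw [← card_union_of_disjoint]
        · symm
          refine card_bij (fun g _ => Fin.cons a g) ?_ ?_ ?_
          · intro g hg
            simp only [mem_union, mem_filter, mem_univ, true_and] at hg
            simp only [mem_filter, mem_univ, true_and, Fin.cons_zero, and_true]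
            rw [image_univ_eq_insert_tail, Fin.cons_zero, Fin.tail_cons]
            rcases hg with hg | hg <;> rw [hg]
            · exact insert_eq_of_mem ha
            · exact insert_erase ha
          · intro g _ g' _ h
            exact Fin.cons_right_injective _ h
          · intro f hf
            simp only [mem_filter, mem_univ, true_and] at hf
            obtain ⟨hf, rfl⟩ := hf
            refine ⟨Fin.tail f, ?_, Fin.cons_self_tail f⟩
            have h := image_univ_eq_insert_tail f
            rw [hf] at h
            simp only [mem_union, mem_filter, mem_univ, true_and]
            by_cases h0 : f 0 ∈ univ.image (Fin.tail f)
            · left; rw [h, insert_eq_of_mem h0]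
            · right; rw [h, erase_insert h0]
        · rw [disjoint_left]
          intro g hg hg'
          simp only [mem_filter, mem_univ, true_and] at hg hg'
          exact notMem_erase a D (hg' ▸ hg ▸ ha)
      · intro f hf
        simp only [coe_filter, mem_univ, true_and, Set.mem_ofPred_eq] at hf
        simp [← hf]
    rw [key]
    rcases D.eq_empty_or_nonempty with rfl | hD
    · simp
    · obtain ⟨k, hk⟩ := Nat.exists_eq_succ_of_ne_zero hD.card_pos.ne'
      rw [sum_congr rfl fun a ha => by rw [ih, ih, card_erase_of_mem ha], sum_const, hk]
      simp only [Nat.succ_eq_add_one, Nat.add_sub_cancel, smul_eq_mul,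
        Nat.stirlingSecond_succ_succ, Nat.factorial_succ]
      ring

theorem card_piAntidiag_univ_fin (m T : ℕ) :
    #(piAntidiag (univ : Finset (Fin (m + 1))) T) = (T + m).choose m := by
  have h : #(finsuppAntidiag (univ : Finset (Fin (m + 1))) T) =
      #(piAntidiag (univ : Finset (Fin (m + 1))) T) := by
    refine card_bij (fun f _ => f) ?_ ?_ ?_
    · intro f hf
      simpa using hf
    · intro f _ g _ h
      exact DFunLike.coe_injective h
    · intro f hf
      exact ⟨Finsupp.equivFunOnFinite.symm f, by simpa using hf, by simp⟩
  rw [← h, card_finsuppAntidiag_nat_eq_choose, card_univ, Fintype.card_fin,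
    ← Nat.choose_symm_add]
  congr 1
  omega

theorem mem_iff_lt_card_of_isLowerSet {n : ℕ} {S : Finset (Fin n)}
    (hS : ∀ a ∈ S, ∀ b < a, b ∈ S) (r : Fin n) : r ∈ S ↔ (r : ℕ) < #S := by
  constructor
  · intro hr
    have : Iic r ⊆ S := fun b hb => by
      rcases (mem_Iic.1 hb).eq_or_lt with rfl | h
      · exact hr
      · exact hS r hr b h
    have := card_le_card this
    rw [Fin.card_Iic] at this
    omega
  · intro hr
    by_contra h
    have : S ⊆ Iio r := fun b hb => by
      rw [mem_Iio]
      by_contra hbr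
      rcases (not_lt.1 hbr).eq_or_lt with rfl | h'
      · exact h hb
      · exact h (hS b hb r h')
    have := card_le_card this
    rw [Fin.card_Iio] at this
    omega

/-- The number of ranks used in section `i`. -/
def blockCount {m ℓ : ℕ} (f : Fin ℓ → Fin (m + 1) × Fin ℓ) (i : Fin (m + 1)) : ℕ :=
  #{r : Fin ℓ | (i, r) ∈ univ.image f}

/-- The pairs (section, rank) used by an arrangement with `t i` blocks in section `i`. -/
def blockSet {m : ℕ} (ℓ : ℕ) (t : Fin (m + 1) → ℕ) : Finset (Fin (m + 1) × Fin ℓ) :=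
  {p | (p.2 : ℕ) < t p.1}

theorem card_eq_sum_card_section {m ℓ : ℕ} (S : Finset (Fin (m + 1) × Fin ℓ)) :
    #S = ∑ i, #{r : Fin ℓ | (i, r) ∈ S} := by
  rw [card_eq_sum_card_fiberwise (f := Prod.fst) (t := univ) (by simp)]
  refine sum_congr rfl fun i _ => ?_
  symm
  refine card_bij (fun r _ => (i, r)) ?_ ?_ ?_
  · intro r hr
    simpa using hr
  · intro r _ r' _ h
    simpa using h
  · rintro ⟨j, r⟩ h
    simp only [mem_filter] at h
    obtain ⟨h, rfl⟩ := h
    exact ⟨r, by simpa using h, rfl⟩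

theorem sum_blockCount_le {m ℓ : ℕ} (f : Fin ℓ → Fin (m + 1) × Fin ℓ) :
    ∑ i, blockCount f i ≤ ℓ := by
  unfold blockCount
  rw [← card_eq_sum_card_section]
  exact card_image_le.trans (by simp)

theorem card_section_blockSet {m ℓ : ℕ} {t : Fin (m + 1) → ℕ} (ht : ∀ i, t i ≤ ℓ)
    (i : Fin (m + 1)) : #{r : Fin ℓ | (i, r) ∈ blockSet ℓ t} = t i := by
  simp [blockSet, Fin.card_filter_val_lt, ht i]

theorem isBPA_and_blockCount_eq_iff {m ℓ : ℕ} {t : Fin (m + 1) → ℕ} (ht : ∀ i, t i ≤ ℓ)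
    (f : Fin ℓ → Fin (m + 1) × Fin ℓ) :
    IsBPA m ℓ f ∧ blockCount f = t ↔ univ.image f = blockSet ℓ t := by
  constructor
  · rintro ⟨hf, rfl⟩
    ext ⟨i, r⟩
    have := mem_iff_lt_card_of_isLowerSet (S := {r : Fin ℓ | (i, r) ∈ univ.image f}) (by
      intro a ha b hb
      simp only [mem_filter, mem_univ, true_and, mem_image] at ha ⊢
      obtain ⟨x, hx⟩ := ha
      obtain ⟨y, hy, hy'⟩ := hf x b (by rw [hx]; exact hb)
      exact ⟨y, Prod.ext (by rw [hy, hx]) hy'⟩) r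
    rw [mem_filter] at this
    simpa [blockSet, blockCount] using this
  · intro h
    refine ⟨fun x r hr => ?_, ?_⟩
    · have hx : f x ∈ blockSet ℓ t := h ▸ mem_image_of_mem f (mem_univ x)
      have hy : ((f x).1, r) ∈ univ.image f := by
        rw [h]
        simp only [blockSet, mem_filter, mem_univ, true_and] at hx ⊢
        exact lt_trans hr hx
      obtain ⟨y, -, hy⟩ := mem_image.1 hy
      exact ⟨y, by rw [hy], by rw [hy]⟩
    · ext i
      rw [blockCount, h, card_section_blockSet ht]

theorem bpa_eq_sum (m ℓ : ℕ) :
    bpa m ℓ = ∑ T ∈ range (ℓ + 1),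
      (T + m).choose m * (T.factorial * ℓ.stirlingSecond T) := by
  rw [bpa, Fintype.card_subtype,
    card_eq_sum_card_fiberwise (f := fun f => ∑ i, blockCount f i) (t := range (ℓ + 1))]
  · refine sum_congr rfl fun T hT => ?_
    rw [card_eq_sum_card_fiberwise (f := blockCount) (t := piAntidiag univ T),
      ← card_piAntidiag_univ_fin, ← smul_eq_mul, ← sum_const]
    · refine sum_congr rfl fun t ht => ?_
      have hsum : ∑ i, t i = T := by simpa using ht
      have htl : ∀ i, t i ≤ ℓ := fun i =>
        (single_le_sum (fun _ _ => Nat.zero_le _) (mem_univ i)).trans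
          (hsum.le.trans (Nat.lt_succ_iff.1 (mem_range.1 hT)))
      have hcard : #(blockSet ℓ t) = T := by
        rw [card_eq_sum_card_section, ← hsum]
        exact sum_congr rfl fun i _ => card_section_blockSet htl i
      rw [← hcard, ← card_filter_image_eq]
      congr 1
      ext f
      simp only [mem_filter, mem_univ, true_and, ← isBPA_and_blockCount_eq_iff htl, hcard]
      constructor
      · rintro ⟨⟨h, -⟩, h'⟩
        exact ⟨h, h'⟩
      · rintro ⟨h, rfl⟩
        exact ⟨⟨h, hsum⟩, rfl⟩
    · intro f hf
      simp only [coe_filter, mem_filter, mem_univ, true_and, Set.mem_ofPred_eq] at hf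
      simpa using hf.2
  · intro f _
    simpa [Nat.lt_succ_iff] using sum_blockCount_le f

/-- The number of surjections from an `n`-element set onto a `k`-element set. -/
def surjCount (n k : ℕ) : ℕ := k.factorial * n.stirlingSecond k

theorem surjCount_eq_zero_of_lt {n k : ℕ} (h : n < k) : surjCount n k = 0 := by
  simp [surjCount, Nat.stirlingSecond_eq_zero_of_lt h]

theorem surjCount_succ_zero (n : ℕ) : surjCount (n + 1) 0 = 0 := by simp [surjCount]

theorem surjCount_succ_succ (n k : ℕ) :
    surjCount (n + 1) (k + 1) = (k + 1) * (surjCount n (k + 1) + surjCount n k) := by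
  simp only [surjCount, Nat.stirlingSecond_succ_succ, Nat.factorial_succ]
  ring

theorem bpa_eq_sum_of_lt (m : ℕ) {ℓ N : ℕ} (h : ℓ < N) :
    bpa m ℓ = ∑ T ∈ range N, (T + m).choose m * surjCount ℓ T := by
  rw [bpa_eq_sum]
  refine sum_subset (range_subset_range.2 h) fun T _ hT => ?_
  rw [← surjCount, surjCount_eq_zero_of_lt (by simpa using hT), mul_zero]

theorem two_mul_succ_mul_bpa_succ (m ℓ : ℕ) :
    2 * (m + 1) * bpa (m + 1) ℓ = bpa m (ℓ + 1) + (m + 1) * bpa m ℓ := by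
  rw [bpa_eq_sum_of_lt (m + 1) (Nat.lt_succ_self ℓ),
    bpa_eq_sum_of_lt m (Nat.lt_succ_self (ℓ + 1)), sum_range_succ' _ (ℓ + 1), surjCount_succ_zero,
    mul_zero, add_zero]
  have hshift : ∑ T ∈ range (ℓ + 1), (T + 1 + m).choose m * ((T + 1) * surjCount ℓ (T + 1)) =
      ∑ T ∈ range (ℓ + 1), (T + m).choose m * (T * surjCount ℓ T) := by
    have h := sum_range_succ' (fun T => (T + m).choose m * (T * surjCount ℓ T)) (ℓ + 1)
    rw [sum_range_succ, surjCount_eq_zero_of_lt (Nat.lt_succ_self ℓ)] at h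
    simpa using h.symm
  have hsplit : ∑ T ∈ range (ℓ + 1), (T + 1 + m).choose m * surjCount (ℓ + 1) (T + 1) =
      ∑ T ∈ range (ℓ + 1), (T + m).choose m * (T * surjCount ℓ T) +
      ∑ T ∈ range (ℓ + 1), (T + 1 + m).choose m * ((T + 1) * surjCount ℓ T) := by
    rw [← hshift, ← sum_add_distrib]
    refine sum_congr rfl fun T _ => ?_
    rw [surjCount_succ_succ]
    ring
  rw [hsplit, bpa_eq_sum_of_lt m (Nat.lt_succ_self ℓ), mul_sum, mul_sum, ← sum_add_distrib,
    ← sum_add_distrib]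
  refine sum_congr rfl fun T _ => ?_
  have h1 : (T + m + 1) * (T + m).choose m = (m + 1) * (T + (m + 1)).choose (m + 1) := by
    rw [← add_assoc, Nat.add_one_mul_choose_eq, mul_comm]
  have h2 : (T + 1) * (T + 1 + m).choose m = (m + 1) * (T + (m + 1)).choose (m + 1) := by
    have := Nat.choose_succ_right_eq (T + (m + 1)) m
    rw [show T + (m + 1) - m = T + 1 by omega] at this
    rw [show T + 1 + m = T + (m + 1) by omega]
    linarith
  calc _ = surjCount ℓ T * ((m + 1) * (T + (m + 1)).choose (m + 1) +
        (m + 1) * (T + (m + 1)).choose (m + 1)) := by ring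
    _ = _ := by
      nth_rewrite 1 [← h1]
      rw [← h2]
      ring

theorem sum_choose_mul_succ (n : ℕ) (a : ℕ → ℕ) :
    ∑ k ∈ range (n + 2), (n + 1).choose k * a k =
      ∑ k ∈ range (n + 1), n.choose k * a k + ∑ k ∈ range (n + 1), n.choose k * a (k + 1) := by
  rw [sum_range_succ', Nat.choose_zero_right]
  simp only [Nat.choose_succ_succ', add_mul, sum_add_distrib]
  have h := sum_range_succ' (fun k => n.choose k * a k) (n + 1)
  rw [sum_range_succ, Nat.choose_succ_self, zero_mul, add_zero, Nat.choose_zero_right] at h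
  omega

theorem sum_choose_mul_surjCount (n T : ℕ) :
    ∑ k ∈ range (n + 1), n.choose k * surjCount k T = surjCount n (T + 1) + surjCount n T := by
  induction n generalizing T with
  | zero => simp [surjCount]
  | succ n ih =>
    rw [sum_choose_mul_succ, ih]
    cases T with
    | zero => simp [surjCount_succ_zero, surjCount_succ_succ]
    | succ T =>
      have h : ∑ k ∈ range (n + 1), n.choose k * surjCount (k + 1) (T + 1) =
          (T + 1) * (∑ k ∈ range (n + 1), n.choose k * surjCount k (T + 1) +
            ∑ k ∈ range (n + 1), n.choose k * surjCount k T) := by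
        rw [← sum_add_distrib, mul_sum]
        refine sum_congr rfl fun k _ => ?_
        rw [surjCount_succ_succ]
        ring
      rw [h, ih, ih, surjCount_succ_succ, surjCount_succ_succ]
      ring

theorem sum_choose_mul_bpa_zero (n : ℕ) :
    ∑ k ∈ range (n + 1), n.choose k * bpa 0 k + (if n = 0 then 1 else 0) = 2 * bpa 0 n := by
  have h : ∑ k ∈ range (n + 1), n.choose k * bpa 0 k =
      ∑ T ∈ range (n + 1), (surjCount n (T + 1) + surjCount n T) := by
    rw [sum_congr rfl fun k hk => by rw [bpa_eq_sum_of_lt 0 (mem_range.1 hk), mul_sum], sum_comm]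
    refine sum_congr rfl fun T _ => ?_
    rw [← sum_choose_mul_surjCount]
    simp
  have h' := sum_range_succ' (surjCount n) (n + 1)
  rw [sum_range_succ, surjCount_eq_zero_of_lt (Nat.lt_succ_self n)] at h'
  have h0 : surjCount n 0 = if n = 0 then 1 else 0 := by
    cases n <;> simp [surjCount]
  rw [h, sum_add_distrib, bpa_eq_sum_of_lt 0 (Nat.lt_succ_self n)]
  simp only [add_zero, Nat.choose_zero_right, one_mul, Nat.succ_eq_add_one] at h' ⊢
  omega

/-- The function `z ↦ (log 2 - z) / (2 - exp z)`, with its removable singularity at `log 2`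
filled in. -/
noncomputable def fubiniRegularPart (z : ℂ) : ℂ :=
  (dslope Complex.exp (Real.log 2 : ℂ) z)⁻¹

theorem exp_ofReal_log_two : Complex.exp (Real.log 2 : ℂ) = 2 := by
  rw [← Complex.ofReal_exp, Real.exp_log two_pos, Complex.ofReal_ofNat]

theorem fubiniRegularPart_log_two : fubiniRegularPart (Real.log 2 : ℂ) = 1 / 2 := by
  rw [fubiniRegularPart, dslope_same, Complex.deriv_exp, exp_ofReal_log_two, one_div]

theorem eq_log_two_of_exp_eq_two {z : ℂ} (hz : z ∈ Metric.ball (0 : ℂ) 1)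
    (h : Complex.exp z = 2) : z = (Real.log 2 : ℂ) := by
  have him : |z.im| < 1 := (Complex.abs_im_le_norm z).trans_lt (by simpa using hz)
  obtain ⟨h1, h2⟩ := abs_lt.1 him
  have hpi := Real.pi_gt_three
  rw [← Complex.log_exp (x := z) (by linarith) (by linarith), h]
  exact (Complex.natCast_log (n := 2)).symm

theorem dslope_exp_ne_zero {z : ℂ} (hz : z ∈ Metric.ball (0 : ℂ) 1) :
    dslope Complex.exp (Real.log 2 : ℂ) z ≠ 0 := by
  by_cases h : z = (Real.log 2 : ℂ)
  · rw [h, dslope_same, Complex.deriv_exp]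
    exact Complex.exp_ne_zero _
  · rw [dslope_of_ne _ h, slope_def_field, exp_ofReal_log_two]
    exact div_ne_zero (sub_ne_zero.2 fun h' => h (eq_log_two_of_exp_eq_two hz h'))
      (sub_ne_zero.2 h)

theorem differentiableOn_fubiniRegularPart :
    DifferentiableOn ℂ fubiniRegularPart (Metric.ball 0 1) := by
  refine DifferentiableOn.inv (DifferentiableOn.mono (t := Set.univ) ?_ (Set.subset_univ _))
    fun z hz => dslope_exp_ne_zero hz
  rw [Complex.differentiableOn_dslope univ_mem]
  exact Complex.differentiable_exp.differentiableOn

theorem fubiniRegularPart_mul {z : ℂ} (hz : z ∈ Metric.ball (0 : ℂ) 1) :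
    fubiniRegularPart z * (2 - Complex.exp z) = (Real.log 2 : ℂ) - z := by
  have h := sub_smul_dslope Complex.exp (Real.log 2 : ℂ) z
  rw [exp_ofReal_log_two, smul_eq_mul] at h
  rw [fubiniRegularPart, inv_mul_eq_div, div_eq_iff (dslope_exp_ne_zero hz)]
  linear_combination h

theorem iteratedDeriv_two_sub_exp_zero (n : ℕ) :
    iteratedDeriv n (fun z : ℂ => 2 - Complex.exp z) 0 = (if n = 0 then 2 else 0) - 1 := by
  cases n with
  | zero => norm_num
  | succ n =>
    rw [iteratedDeriv_const_sub n.succ_pos, iteratedDeriv_neg]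
    simp [iteratedDeriv_eq_iterate]

theorem iteratedDeriv_const_sub_id_zero (c : ℂ) (n : ℕ) :
    iteratedDeriv n (fun z : ℂ => c - z) 0 =
      (if n = 0 then c else 0) - (if n = 1 then 1 else 0) := by
  match n with
  | 0 => simp
  | 1 => simp [iteratedDeriv_one]
  | n + 2 =>
    rw [iteratedDeriv_succ']
    simp [iteratedDeriv_succ']

theorem sum_choose_mul_iteratedDeriv_fubiniRegularPart (n : ℕ) :
    2 * iteratedDeriv n fubiniRegularPart 0 -
      ∑ k ∈ range (n + 1), (n.choose k : ℂ) * iteratedDeriv k fubiniRegularPart 0 =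
      (if n = 0 then (Real.log 2 : ℂ) else 0) - (if n = 1 then 1 else 0) := by
  have hball : Metric.ball (0 : ℂ) 1 ∈ 𝓝 0 := Metric.ball_mem_nhds _ one_pos
  have hF : ContDiffAt ℂ n fubiniRegularPart 0 :=
    (differentiableOn_fubiniRegularPart.analyticAt hball).contDiffAt
  have hE : ContDiffAt ℂ n (fun z : ℂ => 2 - Complex.exp z) 0 :=
    contDiffAt_const.sub Complex.contDiff_exp.contDiffAt
  have hev : (fubiniRegularPart * fun z : ℂ => 2 - Complex.exp z) =ᶠ[𝓝 0]
      fun z : ℂ => (Real.log 2 : ℂ) - z := by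
    filter_upwards [hball] with z hz using fubiniRegularPart_mul hz
  rw [← iteratedDeriv_const_sub_id_zero, ← hev.iteratedDeriv_eq n, iteratedDeriv_mul hF hE]
  simp only [iteratedDeriv_two_sub_exp_zero, mul_sub, sum_sub_distrib, mul_one]
  have htop : ∑ k ∈ range (n + 1), (n.choose k : ℂ) * iteratedDeriv k fubiniRegularPart 0 *
      (if n - k = 0 then 2 else 0) = 2 * iteratedDeriv n fubiniRegularPart 0 := by
    rw [sum_range_succ, sum_eq_zero fun k hk => by
      rw [if_neg (Nat.sub_ne_zero_of_lt (mem_range.1 hk)), mul_zero]]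
    simp [mul_comm]
  rw [htop]

theorem eq_of_binomial_recurrence {d e g : ℕ → ℂ}
    (hd : ∀ n, 2 * d n - ∑ k ∈ range (n + 1), (n.choose k : ℂ) * d k = g n)
    (he : ∀ n, 2 * e n - ∑ k ∈ range (n + 1), (n.choose k : ℂ) * e k = g n) (n : ℕ) :
    d n = e n := by
  induction n using Nat.strong_induction_on with
  | _ n ih =>
    have h := (hd n).trans (he n).symm
    rw [sum_range_succ, sum_range_succ, sum_congr rfl fun k hk => by rw [ih k (mem_range.1 hk)],
      Nat.choose_self, Nat.cast_one] at h
    linear_combination h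

theorem iteratedDeriv_fubiniRegularPart (n : ℕ) :
    iteratedDeriv n fubiniRegularPart 0 =
      (Real.log 2 : ℂ) * bpa 0 n - n * bpa 0 (n - 1) := by
  refine eq_of_binomial_recurrence sum_choose_mul_iteratedDeriv_fubiniRegularPart
    (e := fun n => (Real.log 2 : ℂ) * bpa 0 n - n * bpa 0 (n - 1)) (fun n => ?_) n
  have hr (n : ℕ) : ∑ k ∈ range (n + 1), (n.choose k : ℂ) * bpa 0 k =
      2 * bpa 0 n - (if n = 0 then 1 else 0) := by
    rw [eq_sub_iff_add_eq]
    exact_mod_cast sum_choose_mul_bpa_zero n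
  have hr' : ∑ k ∈ range (n + 1), (n.choose k : ℂ) * (k * bpa 0 (k - 1)) =
      2 * (n * bpa 0 (n - 1)) - (if n = 1 then 1 else 0) := by
    cases n with
    | zero => simp
    | succ n =>
      rw [sum_range_succ']
      have h (k : ℕ) : ((n + 1).choose (k + 1) : ℂ) * ((k + 1 : ℕ) * bpa 0 (k + 1 - 1)) =
          (n + 1) * (n.choose k * bpa 0 k) := by
        have : ((n + 1 : ℕ) : ℂ) * n.choose k = (n + 1).choose (k + 1) * (k + 1 : ℕ) := by
          exact_mod_cast Nat.add_one_mul_choose_eq n k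
        rw [Nat.add_sub_cancel, ← mul_assoc, ← this]
        push_cast
        ring
      rw [sum_congr rfl fun k _ => h k, ← mul_sum, hr]
      by_cases hn : n = 0
      · simp [hn]
      · simp [hn]
        ring
  simp only [mul_sub, sum_sub_distrib, mul_left_comm _ (Real.log 2 : ℂ)]
  rw [← mul_sum, hr, hr']
  split_ifs <;> ring

theorem sum_taylor_fubiniRegularPart (n : ℕ) :
    ∑ k ∈ range (n + 1), ((k.factorial : ℂ)⁻¹ • ((Real.log 2 : ℂ) - 0) ^ k •
      iteratedDeriv k fubiniRegularPart 0) =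
      (bpa 0 n * (Real.log 2 : ℂ) ^ (n + 1)) / n.factorial := by
  induction n with
  | zero => simp [iteratedDeriv_fubiniRegularPart, mul_comm]
  | succ n ih =>
    rw [sum_range_succ, ih, iteratedDeriv_fubiniRegularPart, Nat.add_sub_cancel,
      Nat.factorial_succ]
    have h1 : (n.factorial : ℂ) ≠ 0 := by exact_mod_cast n.factorial_ne_zero
    have h2 : (n + 1 : ℂ) ≠ 0 := by exact_mod_cast n.succ_ne_zero
    simp only [smul_eq_mul, sub_zero]
    push_cast
    field_simp
    ring

theorem tendsto_bpa_zero : Tendsto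
    (fun n : ℕ => (bpa 0 n : ℝ) * Real.log 2 ^ (n + 1) / n.factorial) atTop (𝓝 (1 / 2)) := by
  have hmem : (Real.log 2 : ℂ) ∈ Metric.ball (0 : ℂ) 1 := by
    rw [mem_ball_zero_iff, Complex.norm_real, Real.norm_of_nonneg (Real.log_nonneg one_le_two)]
    linarith [Real.log_two_lt_d9]
  have h := (Complex.hasSum_taylorSeries_on_ball differentiableOn_fubiniRegularPart
    hmem).tendsto_sum_nat.comp (tendsto_add_atTop_nat 1)
  rw [fubiniRegularPart_log_two] at h
  have h' := (Complex.continuous_re.tendsto _).comp h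
  convert h' using 1
  · ext n
    simp only [Function.comp_apply, sum_taylor_fubiniRegularPart]
    norm_cast
  · norm_num

/-- The asymptotic main term of `bpa m ℓ`. -/
noncomputable def bpaMainTerm (m ℓ : ℕ) : ℝ :=
  (Nat.factorial (ℓ + m) : ℝ) /
    (2 ^ (m + 1) * (Nat.factorial m : ℝ) * Real.log 2 ^ (ℓ + m + 1))

theorem bpa_succ_div_mainTerm (m ℓ : ℕ) :
    (bpa (m + 1) ℓ : ℝ) / bpaMainTerm (m + 1) ℓ =
      bpa m (ℓ + 1) / bpaMainTerm m (ℓ + 1) +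
        bpa m ℓ / bpaMainTerm m ℓ * ((m + 1) * Real.log 2 / ((ℓ + m + 1 : ℕ) : ℝ)) := by
  have hrec : 2 * ((m : ℝ) + 1) * bpa (m + 1) ℓ = bpa m (ℓ + 1) + (m + 1) * bpa m ℓ := by
    exact_mod_cast two_mul_succ_mul_bpa_succ m ℓ
  have hL : Real.log 2 ≠ 0 := (Real.log_pos one_lt_two).ne'
  have h1 : ((ℓ + m).factorial : ℝ) ≠ 0 := by exact_mod_cast (ℓ + m).factorial_ne_zero
  have h2 : ((ℓ + m + 1 : ℕ) : ℝ) ≠ 0 := by exact_mod_cast (ℓ + m).succ_ne_zero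
  have h3 : (m.factorial : ℝ) ≠ 0 := by exact_mod_cast m.factorial_ne_zero
  have h4 : (m + 1 : ℝ) ≠ 0 := by exact_mod_cast m.succ_ne_zero
  have hb : (bpa (m + 1) ℓ : ℝ) = (bpa m (ℓ + 1) + (m + 1) * bpa m ℓ) / (2 * (m + 1)) := by
    rw [← hrec]
    field_simp
  rw [hb, bpaMainTerm, bpaMainTerm, bpaMainTerm, show ℓ + 1 + m = ℓ + m + 1 by omega,
    show ℓ + (m + 1) = ℓ + m + 1 by omega, Nat.factorial_succ (ℓ + m), Nat.factorial_succ m,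
    Nat.cast_mul, Nat.cast_mul, Nat.cast_succ m]
  field_simp
  ring

theorem tendsto_bpa_div_mainTerm (m : ℕ) :
    Tendsto (fun ℓ : ℕ => (bpa m ℓ : ℝ) / bpaMainTerm m ℓ) atTop (𝓝 1) := by
  induction m with
  | zero =>
    have h := tendsto_bpa_zero.const_mul 2
    rw [show (2 : ℝ) * (1 / 2) = 1 by norm_num] at h
    refine h.congr fun n => ?_
    simp only [bpaMainTerm, add_zero, zero_add, pow_one, Nat.factorial_zero, Nat.cast_one, mul_one]
    rw [div_div_eq_mul_div]
    ring
  | succ m ih =>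
    have h0 : Tendsto (fun ℓ : ℕ => (m + 1) * Real.log 2 / ((ℓ + m + 1 : ℕ) : ℝ)) atTop (𝓝 0) :=
      (tendsto_natCast_atTop_atTop.comp (tendsto_add_atTop_nat (m + 1))).const_div_atTop _
    have h := (ih.comp (tendsto_add_atTop_nat 1)).add (ih.mul h0)
    rw [mul_zero, add_zero] at h
    exact h.congr fun ℓ => (bpa_succ_div_mainTerm m ℓ).symm

end

/-- For every fixed `m ≥ 0`, as `ℓ → ∞`,
`r_{m,ℓ} ∼ (ℓ+m)! / (2^{m+1} · m! · (log 2)^{ℓ+m+1})`: the ratio of `r_{m,ℓ}` to this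
quantity tends to `1`. -/
theorem bpa_asymptotic (m : ℕ) :
    Filter.Tendsto
      (fun ℓ : ℕ =>
        (bpa m ℓ : ℝ) /
          ((Nat.factorial (ℓ + m) : ℝ) /
            (2 ^ (m + 1) * (Nat.factorial m : ℝ) * Real.log 2 ^ (ℓ + m + 1))))
      Filter.atTop (nhds 1) := by
  exact tendsto_bpa_div_mainTerm m
end
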